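/- arXiv:2003.01666 — 2 statements merged into one kernel-verified Lean document; each statement's English description precedes it below -/
import Mathlib

section
/- Let (x_t) be iterates of a stochastic first order method (SPG or SPP) satisfying the descent recursion with constants L ≥ 0 and 𝓑 > 0, and let F be convex. Fix the number of iterations T such that T𝓑² > R_0² L², where R_0 = ‖x_0 − x̄_0‖, and run with constant stepsize γ = R_0/√(T𝓑²). Then the averaged iterate x̂_T := (1/T) Σ_{j=0}^{T−1} x_j satisfies E[F(x̂_T)] − F* ≤ 2 R_0 𝓑 / √T. -/
open MeasureTheory Finset

/-- Jensen's inequality for uniform averages of points. -/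
lemma ConvexOn.map_inv_smul_sum_range_le {E : Type*} [AddCommGroup E] [Module ℝ E] {F : E → ℝ}
    (hF : ConvexOn ℝ Set.univ F) {T : ℕ} (hT : 1 ≤ T) (y : ℕ → E) :
    F ((T : ℝ)⁻¹ • ∑ j ∈ range T, y j) ≤ (T : ℝ)⁻¹ * ∑ j ∈ range T, F (y j) := by
  have hT0 : (T : ℝ) ≠ 0 := by positivity
  have h := hF.map_sum_le (t := range T) (w := fun _ => (T : ℝ)⁻¹) (p := y)
    (fun _ _ => by positivity) (by simp [hT0]) (fun _ _ => Set.mem_univ _)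
  simpa only [← Finset.smul_sum, smul_eq_mul, ← Finset.mul_sum] using h

/-- Telescoping of a recursion `D (t + 1) ≤ D t - a * e t + b`. -/
lemma add_mul_sum_range_le_of_descent {D e : ℕ → ℝ} {a b : ℝ}
    (h : ∀ t, D (t + 1) ≤ D t - a * e t + b) (T : ℕ) :
    D T + a * ∑ t ∈ range T, e t ≤ D 0 + T * b := by
  induction T with
  | zero => simp
  | succ n ih =>
    rw [sum_range_succ]
    push_cast
    linarith [h n]

/-- With the constant stepsize `R / √(T B²)`, a positive `R` and a nonnegative total gap `S`,
the telescoped descent inequality bounds `S`. -/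
lemma le_two_mul_sqrt_of_descent {R L B S γ : ℝ} {T : ℕ} (hR : 0 < R) (hB : 0 < B)
    (hT : 1 ≤ T) (hlarge : R ^ 2 * L ^ 2 < T * B ^ 2) (hγ : γ = R / √(T * B ^ 2)) (hS : 0 ≤ S)
    (h : γ * (2 - γ * L) * S ≤ R ^ 2 + T * (γ ^ 2 * B ^ 2)) :
    S ≤ 2 * R * B * √T := by
  have hTpos : (0 : ℝ) < T := by positivity
  have hs : 0 < √(T : ℝ) := Real.sqrt_pos.2 hTpos
  have hsq : √(T : ℝ) ^ 2 = T := Real.sq_sqrt hTpos.le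
  have hγs : γ * (√T * B) = R := by
    rw [hγ, Real.sqrt_mul hTpos.le, Real.sqrt_sq hB.le]
    field_simp
  have hγpos : 0 < γ := by
    rw [hγ]
    positivity
  have hRL : R * L < √T * B := by
    apply lt_of_pow_lt_pow_left₀ 2 (by positivity)
    rw [mul_pow, mul_pow, hsq]
    exact hlarge
  have hγL : γ * L ≤ 1 := by
    have hsB : 0 < √T * B := by positivity
    nlinarith
  have hnoise : T * (γ ^ 2 * B ^ 2) = R ^ 2 := by
    rw [← hγs, mul_pow, mul_pow, hsq]
    ring
  have hgap : γ * S ≤ 2 * R ^ 2 := by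
    have := mul_le_mul_of_nonneg_right hγL (mul_nonneg hγpos.le hS)
    nlinarith
  refine le_of_mul_le_mul_left (hgap.trans_eq ?_) hγpos
  linear_combination -2 * R * hγs

/-- Theorem 2.3, O(1/√T) rate: if the iterates of SPG/SPP satisfy the descent recursion
with constants `L ≥ 0`, `𝓑 > 0`, the horizon `T` satisfies `T 𝓑² > R0² L²` and the method
is run with the constant stepsize `γ = R0 / √(T 𝓑²)`, then the averaged iterate
`x̂ T = (1/T) ∑_{j<T} x j` satisfies `E[F(x̂ T)] - F* ≤ 2 R0 𝓑 / √T`. -/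
theorem stmt_3 {m : ℕ} {Θ : Type*} [MeasurableSpace Θ]
    (μprob : Measure Θ) [IsProbabilityMeasure μprob]
    (F : EuclideanSpace ℝ (Fin m) → ℝ)
    (hFconv : ConvexOn ℝ Set.univ F)
    (Xstar : Set (EuclideanSpace ℝ (Fin m))) (hXne : Xstar.Nonempty)
    (Fstar : ℝ)
    (hFstar : ∀ z ∈ Xstar, F z = Fstar)
    (hFmin : ∀ y, Fstar ≤ F y)
    (proj : EuclideanSpace ℝ (Fin m) → EuclideanSpace ℝ (Fin m))
    (hprojmem : ∀ x, proj x ∈ Xstar)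
    (hprojdist : ∀ x, ∀ z ∈ Xstar, ‖x - proj x‖ ≤ ‖x - z‖)
    (x : ℕ → Θ → EuclideanSpace ℝ (Fin m))
    (x0 : EuclideanSpace ℝ (Fin m)) (hx0 : ∀ θ, x 0 θ = x0)
    (hmeas : ∀ t, Measurable (x t))
    (hintdist : ∀ t, Integrable (fun θ => ‖x t θ - proj (x t θ)‖ ^ 2) μprob)
    (hintF : ∀ t, Integrable (fun θ => F (x t θ)) μprob)
    (hintavg : ∀ t : ℕ,
      Integrable (fun θ => F ((t : ℝ)⁻¹ • ∑ j ∈ range t, x j θ)) μprob)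
    (L 𝓑 : ℝ) (hL : 0 ≤ L) (h𝓑 : 0 < 𝓑)
    (R0 : ℝ) (hR0 : R0 = ‖x0 - proj x0‖)
    (T : ℕ) (hT : 1 ≤ T) (hTlarge : R0 ^ 2 * L ^ 2 < (T : ℝ) * 𝓑 ^ 2)
    (γ : ℝ) (hγ : γ = R0 / Real.sqrt ((T : ℝ) * 𝓑 ^ 2))
    (hrec : ∀ t : ℕ,
      ∫ θ, ‖x (t + 1) θ - proj (x (t + 1) θ)‖ ^ 2 ∂μprob ≤
        ∫ θ, ‖x t θ - proj (x t θ)‖ ^ 2 ∂μprob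
          - γ * (2 - γ * L) * ∫ θ, (F (x t θ) - F (proj (x t θ))) ∂μprob
          + γ ^ 2 * 𝓑 ^ 2) :
    (∫ θ, F ((T : ℝ)⁻¹ • ∑ j ∈ range T, x j θ) ∂μprob) - Fstar ≤
      2 * R0 * 𝓑 / Real.sqrt (T : ℝ) := by
  have hgap : ∀ t, ∫ θ, (F (x t θ) - F (proj (x t θ))) ∂μprob = ∫ θ, F (x t θ) ∂μprob - Fstar := by
    intro t
    simp_rw [hFstar _ (hprojmem _)]
    rw [integral_sub (hintF t) (integrable_const _)]
    simp
  have hgap0 : ∀ t, 0 ≤ ∫ θ, F (x t θ) ∂μprob - Fstar := by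
    intro t
    rw [← hgap t]
    exact integral_nonneg fun θ => sub_nonneg.2 ((hFstar _ (hprojmem _)).trans_le (hFmin _))
  simp_rw [hgap] at hrec
  have hD0 : ∫ θ, ‖x 0 θ - proj (x 0 θ)‖ ^ 2 ∂μprob = R0 ^ 2 := by
    simp [hx0, hR0]
  have htel := add_mul_sum_range_le_of_descent
    (D := fun t => ∫ θ, ‖x t θ - proj (x t θ)‖ ^ 2 ∂μprob) hrec
  simp only [hD0] at htel
  have hTpos : (0 : ℝ) < T := by positivity
  have hjensen : (∫ θ, F ((T : ℝ)⁻¹ • ∑ j ∈ range T, x j θ) ∂μprob) - Fstar ≤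
      (T : ℝ)⁻¹ * ∑ t ∈ range T, (∫ θ, F (x t θ) ∂μprob - Fstar) := by
    have h := integral_mono (hintavg T)
      ((integrable_finsetSum (range T) fun j _ => hintF j).const_mul (T : ℝ)⁻¹)
      fun θ => hFconv.map_inv_smul_sum_range_le hT fun j => x j θ
    rw [integral_const_mul, integral_finsetSum _ fun j _ => hintF j] at h
    rw [sum_sub_distrib, sum_const, card_range, nsmul_eq_mul, mul_sub,
      inv_mul_cancel_left₀ hTpos.ne']
    linarith
  have hsum : ∑ t ∈ range T, (∫ θ, F (x t θ) ∂μprob - Fstar) ≤ 2 * R0 * 𝓑 * √T := by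
    rcases (hR0 ▸ norm_nonneg _ : 0 ≤ R0).eq_or_lt with h0 | hpos
    · subst h0
      simp only [zero_div] at hγ
      subst hγ
      have hopt : ∀ t, ∫ θ, F (x t θ) ∂μprob - Fstar = 0 := by
        intro t
        have hD : ∫ θ, ‖x t θ - proj (x t θ)‖ ^ 2 ∂μprob = 0 :=
          le_antisymm (by simpa using htel t) (integral_nonneg fun θ => by positivity)
        have hae := (integral_eq_zero_iff_of_nonneg (fun θ => by positivity) (hintdist t)).1 hD
        rw [← hgap t]
        refine integral_eq_zero_of_ae ?_
        filter_upwards [hae] with θ hθ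
        have hfix : x t θ = proj (x t θ) := by simpa [sub_eq_zero] using hθ
        rw [← hfix]
        simp
      simp [hopt]
    · refine le_two_mul_sqrt_of_descent hpos h𝓑 hT hTlarge hγ (sum_nonneg fun t _ => hgap0 t) ?_
      have hDT : 0 ≤ ∫ θ, ‖x T θ - proj (x T θ)‖ ^ 2 ∂μprob :=
        integral_nonneg fun θ => by positivity
      linarith [htel T]
  refine hjensen.trans ((mul_le_mul_of_nonneg_left hsum (by positivity)).trans_eq ?_)
  have hs : 0 < √(T : ℝ) := Real.sqrt_pos.2 hTpos
  field_simp
  rw [Real.sq_sqrt hTpos.le, mul_comm]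
end

section
/- Let (x_t) be iterates of a stochastic first order method (SPG or SPP) satisfying the descent recursion with constants L > 0 and 𝓑 ≥ 0, let F be convex, run with the variable stepsize γ_t = γ_0/√t where γ_0 = 1/L, and assume the distance of the iterates to the optimal set is uniformly bounded: E[‖x_t − x̄_t‖²] ≤ R² for all t ≥ 0. Then for all t ≥ 1 the averaged iterates x̂_t := (1/t) Σ_{j=0}^{t−1} x_j satisfy E[F(x̂_t)] − F* ≤ (1/√t)(R² L + 2𝓑²/L). -/
open MeasureTheory Finset

/-- Abel summation for a descent recursion with nonincreasing stepsizes, where the potential `D`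
is bounded by `C`. -/
lemma sum_le_of_descent {D G γ : ℕ → ℝ} {C B : ℝ} (hγpos : ∀ t, 0 < γ t) (hγanti : Antitone γ)
    (hD : ∀ t, D t ≤ C) (hrec : ∀ t, γ t * G t ≤ D t - D (t + 1) + γ t ^ 2 * B) (n : ℕ) :
    ∑ j ∈ range (n + 1), G j ≤ (C - D (n + 1)) / γ n + B * ∑ j ∈ range (n + 1), γ j := by
  have hstep (t : ℕ) : G t ≤ (D t - D (t + 1)) / γ t + B * γ t := by
    have h : G t ≤ (D t - D (t + 1) + γ t ^ 2 * B) / γ t := by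
      rw [le_div_iff₀ (hγpos t), mul_comm]
      exact hrec t
    refine h.trans_eq ?_
    have := (hγpos t).ne'
    field_simp
  induction n with
  | zero =>
    have h : (D 0 - D 1) / γ 0 ≤ (C - D 1) / γ 0 :=
      div_le_div_of_nonneg_right (sub_le_sub_right (hD 0) _) (hγpos 0).le
    have h0 := hstep 0
    simp only [zero_add, sum_range_one] at h0 ⊢
    linarith
  | succ n ih =>
    have h : (C - D (n + 1)) / γ n ≤ (C - D (n + 1)) / γ (n + 1) :=
      div_le_div_of_nonneg_left (sub_nonneg.2 (hD _)) (hγpos _) (hγanti n.le_succ)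
    have hs := hstep (n + 1)
    rw [sum_range_succ G, sum_range_succ γ, mul_add]
    have hsplit : (C - D (n + 1)) / γ (n + 1) + (D (n + 1) - D (n + 1 + 1)) / γ (n + 1)
        = (C - D (n + 1 + 1)) / γ (n + 1) := by ring
    linarith

lemma one_div_sqrt_add_one_le {a : ℝ} (ha : 0 ≤ a) :
    1 / √(a + 1) ≤ 2 * (√(a + 1) - √a) := by
  have hpos : 0 < √(a + 1) := Real.sqrt_pos.2 (by linarith)
  rw [div_le_iff₀ hpos]
  nlinarith [Real.sq_sqrt ha, Real.sq_sqrt (by linarith : 0 ≤ a + 1),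
    sq_nonneg (√(a + 1) - √a)]

lemma one_add_sum_one_div_sqrt_le (n : ℕ) :
    1 + ∑ j ∈ range n, 1 / √((j + 1 : ℕ) : ℝ) ≤ 2 * √((n + 1 : ℕ) : ℝ) := by
  rcases n with _ | n
  · simp
  · have h : 1 + ∑ j ∈ range (n + 1), 1 / √((j + 1 : ℕ) : ℝ) ≤ 2 * √((n + 1 : ℕ) : ℝ) := by
      induction n with
      | zero => norm_num
      | succ n ih =>
        rw [sum_range_succ]
        have := one_div_sqrt_add_one_le (a := ((n + 1 : ℕ) : ℝ)) (by positivity)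
        push_cast at *
        linarith
    refine h.trans ?_
    gcongr
    omega

/-- Jensen's inequality for the uniform average of `t` points. -/
lemma ConvexOn.map_average_range_le {E : Type*} [AddCommGroup E] [Module ℝ E] {F : E → ℝ}
    (hF : ConvexOn ℝ Set.univ F) {t : ℕ} (ht : t ≠ 0) (x : ℕ → E) :
    F ((t : ℝ)⁻¹ • ∑ j ∈ range t, x j) ≤ (t : ℝ)⁻¹ * ∑ j ∈ range t, F (x j) := by
  have h := hF.map_sum_le (t := range t) (w := fun _ => (t : ℝ)⁻¹) (p := x)
    (fun _ _ => by positivity) (by simp [ht]) (fun _ _ => Set.mem_univ _)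
  simpa [smul_sum, mul_sum] using h

/-- Theorem 2.4 (sublinear convergence with variable stepsize): if the iterates of SPG/SPP
satisfy the descent recursion with constants `L > 0`, `𝓑 ≥ 0` and variable stepsize
`γ t = γ0/√t` with `γ0 = 1/L` (and `γ 0 = 1/L`), `F` is convex, and the expected squared
distance of the iterates to the optimal set is uniformly bounded by `R²`, then for all
`t ≥ 1` the averaged iterates satisfy `E[F(x̂ t)] - F* ≤ (1/√t)(R² L + 2 𝓑²/L)`. -/
theorem stmt_5 {m : ℕ} {Θ : Type*} [MeasurableSpace Θ]
    (μprob : Measure Θ) [IsProbabilityMeasure μprob]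
    (F : EuclideanSpace ℝ (Fin m) → ℝ)
    (hFconv : ConvexOn ℝ Set.univ F)
    (Xstar : Set (EuclideanSpace ℝ (Fin m))) (hXne : Xstar.Nonempty)
    (Fstar : ℝ)
    (hFstar : ∀ z ∈ Xstar, F z = Fstar)
    (hFmin : ∀ y, Fstar ≤ F y)
    (proj : EuclideanSpace ℝ (Fin m) → EuclideanSpace ℝ (Fin m))
    (hprojmem : ∀ x, proj x ∈ Xstar)
    (hprojdist : ∀ x, ∀ z ∈ Xstar, ‖x - proj x‖ ≤ ‖x - z‖)
    (x : ℕ → Θ → EuclideanSpace ℝ (Fin m))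
    (x0 : EuclideanSpace ℝ (Fin m)) (hx0 : ∀ θ, x 0 θ = x0)
    (hmeas : ∀ t, Measurable (x t))
    (hintdist : ∀ t, Integrable (fun θ => ‖x t θ - proj (x t θ)‖ ^ 2) μprob)
    (hintF : ∀ t, Integrable (fun θ => F (x t θ)) μprob)
    (hintavg : ∀ t : ℕ,
      Integrable (fun θ => F ((t : ℝ)⁻¹ • ∑ j ∈ range t, x j θ)) μprob)
    (L 𝓑 : ℝ) (hL : 0 < L) (h𝓑 : 0 ≤ 𝓑)
    (γ : ℕ → ℝ) (hγ0 : γ 0 = 1 / L)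
    (hγ : ∀ t : ℕ, 1 ≤ t → γ t = (1 / L) / Real.sqrt (t : ℝ))
    (R : ℝ) (hRbound : ∀ t : ℕ, ∫ θ, ‖x t θ - proj (x t θ)‖ ^ 2 ∂μprob ≤ R ^ 2)
    (hrec : ∀ t : ℕ,
      ∫ θ, ‖x (t + 1) θ - proj (x (t + 1) θ)‖ ^ 2 ∂μprob ≤
        ∫ θ, ‖x t θ - proj (x t θ)‖ ^ 2 ∂μprob
          - γ t * (2 - γ t * L) * ∫ θ, (F (x t θ) - F (proj (x t θ))) ∂μprob
          + (γ t) ^ 2 * 𝓑 ^ 2) :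
    ∀ t : ℕ, 1 ≤ t →
      (∫ θ, F ((t : ℝ)⁻¹ • ∑ j ∈ range t, x j θ) ∂μprob) - Fstar ≤
        (1 / Real.sqrt (t : ℝ)) * (R ^ 2 * L + 2 * 𝓑 ^ 2 / L) := by
  have hγpos (t : ℕ) : 0 < γ t := by
    rcases t with _ | t
    · rw [hγ0]
      positivity
    · rw [hγ _ (by omega)]
      positivity
  have hγanti : Antitone γ := by
    refine antitone_nat_of_succ_le fun t => ?_
    rcases t with _ | t
    · simp [hγ0, hγ 1 le_rfl]
    · rw [hγ _ (by omega), hγ _ (by omega)]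
      gcongr
      omega
  have hγL (t : ℕ) : γ t * L ≤ 1 := by
    have h := mul_le_mul_of_nonneg_right (hγanti t.zero_le) hL.le
    rwa [hγ0, one_div_mul_cancel hL.ne'] at h
  set D : ℕ → ℝ := fun t => ∫ θ, ‖x t θ - proj (x t θ)‖ ^ 2 ∂μprob
  set G : ℕ → ℝ := fun t => (∫ θ, F (x t θ) ∂μprob) - Fstar
  have hG (t : ℕ) : ∫ θ, (F (x t θ) - F (proj (x t θ))) ∂μprob = G t := by
    simp_rw [hFstar _ (hprojmem _)]
    rw [integral_sub (hintF t) (integrable_const _)]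
    simp [G]
  have hGnonneg (t : ℕ) : 0 ≤ G t := by
    rw [← hG]
    exact integral_nonneg fun θ => by simp [hFstar _ (hprojmem _), hFmin]
  have hdescent (t : ℕ) : γ t * G t ≤ D t - D (t + 1) + γ t ^ 2 * 𝓑 ^ 2 := by
    have h := hrec t
    rw [hG] at h
    have := mul_nonneg (mul_nonneg (hγpos t).le (hGnonneg t)) (sub_nonneg.2 (hγL t))
    linarith
  intro t ht
  obtain ⟨n, rfl⟩ : ∃ n, t = n + 1 := ⟨t - 1, by omega⟩
  have hspos : 0 < √((n + 1 : ℕ) : ℝ) := by positivity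
  have hjensen : (∫ θ, F (((n + 1 : ℕ) : ℝ)⁻¹ • ∑ j ∈ range (n + 1), x j θ) ∂μprob) - Fstar
      ≤ ((n + 1 : ℕ) : ℝ)⁻¹ * ∑ j ∈ range (n + 1), G j := by
    have h := integral_mono (hintavg (n + 1))
      ((integrable_finsetSum (range (n + 1)) fun j _ => hintF j).const_mul
        ((n + 1 : ℕ) : ℝ)⁻¹)
      (fun θ => hFconv.map_average_range_le n.succ_ne_zero fun j => x j θ)
    rw [integral_const_mul, integral_finsetSum _ fun j _ => hintF j] at h
    have hsum : ((n + 1 : ℕ) : ℝ)⁻¹ * ∑ j ∈ range (n + 1), G j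
        = ((n + 1 : ℕ) : ℝ)⁻¹ * (∑ j ∈ range (n + 1), ∫ θ, F (x j θ) ∂μprob) - Fstar := by
      simp only [G, sum_sub_distrib, sum_const, card_range, nsmul_eq_mul]
      field_simp
    linarith
  have hinv : 1 / γ n ≤ L * √((n + 1 : ℕ) : ℝ) := by
    rw [div_le_iff₀ (hγpos n)]
    have h := mul_le_mul_of_nonneg_right (hγanti n.le_succ) (mul_pos hL hspos).le
    rw [hγ _ (by omega)] at h
    have h1 : 1 / L / √((n + 1 : ℕ) : ℝ) * (L * √((n + 1 : ℕ) : ℝ)) = 1 := by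
      field_simp
    rw [h1] at h
    linarith
  have hsumγ : ∑ j ∈ range (n + 1), γ j ≤ 2 * √((n + 1 : ℕ) : ℝ) / L := by
    have h : ∑ j ∈ range (n + 1), γ j
        = (1 + ∑ j ∈ range n, 1 / √((j + 1 : ℕ) : ℝ)) / L := by
      rw [sum_range_succ', hγ0, sum_congr rfl fun j _ => hγ (j + 1) (by omega), add_div, sum_div,
        add_comm]
      simp only [div_right_comm]
    rw [h]
    exact div_le_div_of_nonneg_right (one_add_sum_one_div_sqrt_le n) hL.le
  have hDnonneg : 0 ≤ D (n + 1) := integral_nonneg fun θ => by positivity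
  have hpot : (R ^ 2 - D (n + 1)) / γ n ≤ R ^ 2 * (L * √((n + 1 : ℕ) : ℝ)) :=
    calc (R ^ 2 - D (n + 1)) / γ n ≤ R ^ 2 / γ n :=
          div_le_div_of_nonneg_right (by linarith) (hγpos n).le
      _ = R ^ 2 * (1 / γ n) := by ring
      _ ≤ _ := by gcongr
  have hsum : ∑ j ∈ range (n + 1), G j
      ≤ R ^ 2 * (L * √((n + 1 : ℕ) : ℝ)) + 𝓑 ^ 2 * (2 * √((n + 1 : ℕ) : ℝ) / L) :=
    (sum_le_of_descent hγpos hγanti hRbound hdescent n).trans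
      (add_le_add hpot (mul_le_mul_of_nonneg_left hsumγ (sq_nonneg 𝓑)))
  refine hjensen.trans
    ((mul_le_mul_of_nonneg_left hsum (by positivity)).trans_eq ?_)
  have hsq : ((n + 1 : ℕ) : ℝ)⁻¹ = (1 / √((n + 1 : ℕ) : ℝ)) * (1 / √((n + 1 : ℕ) : ℝ)) := by
    rw [one_div_mul_one_div, Real.mul_self_sqrt (by positivity), one_div]
  rw [hsq]
  field_simp
end
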